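/- A pointwise periodic homeomorphism of a compact manifold is periodic: if every point has finite order under F, then F^n = id for some n ≥ 1 (Montgomery's theorem, in the special case of the 2-sphere). -/

import Mathlib

/-- The 2-sphere, as the unit sphere in Euclidean 3-space. -/
noncomputable abbrev Sphere2 : Set (EuclideanSpace ℝ (Fin 3)) :=
  Metric.sphere (0 : EuclideanSpace ℝ (Fin 3)) 1

section PPHelpers

open Set Filter Topology Metric

theorem pp_lift_exp {X : Type*} [TopologicalSpace X] [SimplyConnectedSpace X]
    [LocallyPathConnectedSpace X] (g : X → ℂ) (hg : Continuous g) (h0 : ∀ x, g x ≠ 0) :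
    ∃ φ : X → ℂ, Continuous φ ∧ ∀ x, g x = Complex.exp (φ x) := by
  obtain ⟨x0⟩ : Nonempty X := inferInstance
  obtain ⟨F, ⟨-, hF⟩, -⟩ := Complex.isCoveringMapOn_exp.existsUnique_continuousMap_lifts
    (⟨g, hg⟩ : C(X, ℂ)) (a₀ := x0) (e₀ := Complex.log (g x0)) (by simp [Complex.exp_log (h0 x0)])
    (by intro a; simpa using h0 a)
  exact ⟨F, F.continuous, fun x => by simpa using (congrFun hF x).symm⟩

theorem pp_const_of_exp_eq_one {X : Type*} [TopologicalSpace X] [PreconnectedSpace X]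
    (f : X → ℂ) (hf : Continuous f) (h1 : ∀ x, Complex.exp (f x) = 1) (x y : X) : f x = f y := by
  have := Complex.isCoveringMap_exp.eq_of_comp_eq (A := X) (g₁ := f) (g₂ := fun _ => f y) hf
    continuous_const (by ext z; simp [h1]) y rfl
  exact congrFun this x

theorem pp_winding_punctured (G : ℂ → ℂ) (hG : ContinuousOn G {0}ᶜ) (h0 : ∀ x, x ≠ 0 → G x ≠ 0) :
    ∃ (n : ℤ) (φ : ℂ → ℂ), ContinuousOn φ {0}ᶜ ∧ ∀ x, x ≠ 0 → G x = x ^ n * Complex.exp (φ x) := by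
  obtain ⟨θ, hθ, hθe⟩ := pp_lift_exp (fun w : ℂ => G (Complex.exp w))
    (hG.comp_continuous Complex.continuous_exp (by simp)) (fun w => h0 _ (Complex.exp_ne_zero w))
  set P : ℂ := 2 * Real.pi * Complex.I with hP
  have hP0 : P ≠ 0 := Complex.two_pi_I_ne_zero
  have hc : ∀ w, θ (w + P) - θ w = θ (0 + P) - θ 0 := fun w =>
    pp_const_of_exp_eq_one (fun w => θ (w + P) - θ w) (by fun_prop) (by
      intro w
      rw [Complex.exp_sub, ← hθe, ← hθe, hP, Complex.exp_periodic w]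
      exact div_self (h0 _ (Complex.exp_ne_zero w))) w 0
  obtain ⟨n, hn⟩ : ∃ n : ℤ, θ (0 + P) - θ 0 = n * P := by
    apply Complex.exp_eq_one_iff.mp
    rw [Complex.exp_sub, ← hθe, ← hθe, hP, Complex.exp_periodic 0]
    exact div_self (h0 _ (Complex.exp_ne_zero 0))
  let ψ : ℂ → ℂ := fun w => θ w - n * w
  have hψ : Function.Periodic ψ P := by
    intro w
    have := hc w
    simp only [ψ]
    rw [hn] at this
    linear_combination this
  have hlog : ∀ w, ψ (Complex.log (Complex.exp w)) = ψ w := by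
    intro w
    obtain ⟨k, hk⟩ := Complex.exp_eq_exp_iff_exists_int.mp
      (Complex.exp_log (Complex.exp_ne_zero w))
    rw [hk]
    exact hψ.int_mul k w
  refine ⟨n, fun x => ψ (Complex.log x), ?_, ?_⟩
  · have hq := Complex.isAddQuotientCoveringMap_exp.toIsQuotientMap
    rw [continuousOn_iff_continuous_domRestrict]
    have : Continuous (fun x : {z : ℂ // z ≠ 0} => ψ (Complex.log x)) := by
      rw [hq.continuous_iff]
      have : (fun x : {z : ℂ // z ≠ 0} => ψ (Complex.log x)) ∘
        (fun z : ℂ ↦ (⟨_, z.exp_ne_zero⟩ : {z : ℂ // z ≠ 0})) = ψ := by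
        ext w; exact hlog w
      rw [this]
      simp only [ψ]; fun_prop
    exact this
  · intro x hx
    have := hθe (Complex.log x)
    simp only [Complex.exp_log hx] at this
    rw [this]
    simp only [ψ]
    rw [Complex.exp_sub, Complex.exp_int_mul, Complex.exp_log hx]
    field_simp

theorem pp_winding_circle (g : ℂ → ℂ) (a : ℂ) (s : ℝ) (hs : 0 < s)
    (hg : ContinuousOn g (sphere a s)) (h0 : ∀ x ∈ sphere a s, g x ≠ 0) :
    ∃ (n : ℤ) (φ : ℂ → ℂ), ContinuousOn φ (sphere a s) ∧
      ∀ x ∈ sphere a s, g x = (x - a) ^ n * Complex.exp (φ x) := by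
  let r : ℂ → ℂ := fun x => a + s * (x / ‖x‖)
  have hr : ∀ x, x ≠ 0 → r x ∈ sphere a s := by
    intro x hx
    simp [r, abs_of_pos hs, hx]
  obtain ⟨n, φ, hφ, h⟩ := pp_winding_punctured (fun x => g (r x))
    (hg.comp (by
      intro x hx
      have : (‖x‖ : ℂ) ≠ 0 := by simpa using hx
      apply ContinuousAt.continuousWithinAt
      simp only [r]
      fun_prop (disch := assumption)) (fun x hx => hr x hx)) (fun x hx => h0 _ (hr x hx))
  have hne : ∀ x ∈ sphere a s, x - a ≠ 0 := by
    intro x hx h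
    rw [mem_sphere, dist_eq_norm, h] at hx
    simp at hx; linarith
  refine ⟨n, fun x => φ (x - a), hφ.comp (by fun_prop) (fun x hx => hne x hx), ?_⟩
  intro x hx
  rw [← h _ (hne x hx)]
  congr 1
  simp only [r]
  rw [mem_sphere, dist_eq_norm] at hx
  rw [hx]
  have : (s : ℂ) ≠ 0 := by exact_mod_cast hs.ne'
  field_simp
  ring

theorem pp_winding_unique (m : ℤ) (ρ : ℝ) (hρ : 0 < ρ) (φ : ℂ → ℂ)
    (hφ : ContinuousOn φ (sphere 0 ρ)) (h : ∀ x ∈ sphere (0 : ℂ) ρ, x ^ m = Complex.exp (φ x)) :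
    m = 0 := by
  let c : ℝ → ℂ := fun t => Complex.exp (t * Complex.I + Real.log ρ)
  have hc : ∀ t, c t ∈ sphere (0 : ℂ) ρ := by
    intro t
    simp [c, Complex.norm_exp, Real.exp_log hρ]
  have hcc : Continuous c := by simp only [c]; fun_prop
  have := pp_const_of_exp_eq_one (fun t : ℝ => m * (t * Complex.I + Real.log ρ) - φ (c t))
    (by
      have : Continuous fun t => φ (c t) := hφ.comp_continuous hcc hc
      refine Continuous.sub ?_ this
      fun_prop)
    (by
      intro t
      rw [Complex.exp_sub, ← h _ (hc t), Complex.exp_int_mul]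
      exact div_self (zpow_ne_zero _ (Complex.exp_ne_zero _))) (2 * Real.pi) 0
  have hcp : c (2 * Real.pi) = c 0 := by
    simp only [c]
    rw [Complex.exp_eq_exp_iff_exists_int]
    exact ⟨1, by push_cast; ring⟩
  rw [hcp] at this
  have h2 : (m : ℂ) * (2 * Real.pi * Complex.I) = 0 := by
    push_cast at this
    linear_combination this
  rcases mul_eq_zero.mp h2 with h3 | h3
  · exact_mod_cast h3
  · exact absurd h3 Complex.two_pi_I_ne_zero

theorem pp_tietze (s : Set ℂ) (hs : IsClosed s) (f : ℂ → ℂ) (hf : ContinuousOn f s) :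
    ∃ F : ℂ → ℂ, Continuous F ∧ ∀ x ∈ s, F x = f x := by
  obtain ⟨F, hF⟩ := ContinuousMap.exists_restrict_eq hs
    (⟨s.domRestrict f, continuousOn_iff_continuous_domRestrict.mp hf⟩ : C(s, ℂ))
  refine ⟨F, F.continuous, fun x hx => ?_⟩
  exact DFunLike.congr_fun hF ⟨x, hx⟩

theorem pp_exists_retraction (a : ℂ) (s : ℝ) (hs : 0 < s) :
    ∃ r : ℂ → ℂ, Continuous r ∧ (∀ x, r x ∈ closedBall a s) ∧ ∀ x ∈ closedBall a s, r x = x := by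
  refine ⟨fun x => a + ((s / max s ‖x - a‖ : ℝ) : ℂ) * (x - a), ?_, ?_, ?_⟩
  · have : ∀ x : ℂ, max s ‖x - a‖ ≠ 0 := fun x => (lt_max_of_lt_left hs).ne'
    fun_prop (disch := assumption)
  · intro x
    have : 0 < max s ‖x - a‖ := lt_max_of_lt_left hs
    rw [mem_closedBall, dist_eq_norm, add_sub_cancel_left, norm_mul, Complex.norm_real,
      Real.norm_of_nonneg (by positivity), div_mul_eq_mul_div, div_le_iff₀ this]
    exact mul_le_mul_of_nonneg_left (le_max_right _ _) hs.le
  · intro x hx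
    rw [mem_closedBall, dist_eq_norm] at hx
    simp [max_eq_left hx, hs.ne']

theorem pp_log_ball (g : ℂ → ℂ) (a : ℂ) (s : ℝ) (hs : 0 < s)
    (hg : ContinuousOn g (closedBall a s)) (h0 : ∀ x ∈ closedBall a s, g x ≠ 0) :
    ∃ φ : ℂ → ℂ, Continuous φ ∧ ∀ x ∈ closedBall a s, g x = Complex.exp (φ x) := by
  obtain ⟨r, hr, hrm, hrx⟩ := pp_exists_retraction a s hs
  obtain ⟨φ, hφ, h⟩ := pp_lift_exp (fun x => g (r x)) (hg.comp_continuous hr hrm)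
    (fun x => h0 _ (hrm x))
  exact ⟨φ, hφ, fun x hx => by rw [← h x, hrx x hx]⟩

theorem pp_perturb (g : ℂ → ℂ) (a : ℂ) (s s' ε : ℝ) (hε : 0 < ε)
    (hg : ContinuousOn g (closedBall a s)) :
    ∃ q : ℂ → ℂ, Continuous q ∧ (∀ x ∈ closedBall a s, ‖q x - g x‖ < ε) ∧
      ∀ x ∈ sphere a s', q x ≠ 0 := by
  obtain ⟨G, hG, hGg⟩ := pp_tietze _ isClosed_closedBall g hg
  obtain ⟨f, hf, hfG, -⟩ := hG.exists_contDiff_approx (F := ℂ) 1 (ε := fun _ => ε / 2)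
    continuous_const (fun _ => by positivity)
  let c : ℝ → ℂ := fun t => f (a + s' * Complex.exp (t * Complex.I))
  have hc : ContDiff ℝ 1 c := by
    apply ContDiff.comp (g := f)
    · exact_mod_cast hf
    · have h1 : ContDiff ℝ 1 (fun t : ℝ => (t : ℂ)) := Complex.ofRealCLM.contDiff
      have h2 : ContDiff ℝ 1 (fun t : ℝ => Complex.exp (t * Complex.I)) :=
        (h1.mul contDiff_const).cexp
      exact contDiff_const.add (contDiff_const.mul h2)
  have hd := hc.dense_compl_range_of_finrank_lt_finrank (by simp)
  obtain ⟨η, hη, hηd⟩ := hd.exists_dist_lt 0 (half_pos hε)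
  refine ⟨fun x => f x - η, hf.continuous.sub continuous_const, ?_, ?_⟩
  · intro x hx
    have h1 := hfG x
    rw [hGg x hx, dist_eq_norm] at h1
    rw [dist_comm, dist_zero_right] at hηd
    calc ‖f x - η - g x‖ = ‖(f x - g x) - η‖ := by ring_nf
      _ ≤ ‖f x - g x‖ + ‖η‖ := norm_sub_le _ _
      _ < ε := by linarith
  · intro x hx h
    apply hη
    refine ⟨Complex.arg (x - a), ?_⟩
    simp only [c]
    rw [sub_eq_zero] at h
    rw [← h]
    congr 1
    have := Complex.norm_mul_exp_arg_mul_I (x - a)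
    rw [mem_sphere, dist_eq_norm] at hx
    rw [hx] at this
    rw [this]; ring

theorem pp_local (g : ℂ → ℂ) (a : ℂ) (s s' : ℝ) (hs' : 0 < s') (hss : s' < s)
    (hg : ContinuousOn g (closedBall a s)) (T : Set ℂ) (hT : IsOpen T)
    (hz : ∀ x ∈ closedBall a s, g x = 0 → x ∈ T) :
    ∃ (n : ℤ) (g1 : ℂ → ℂ), ContinuousOn g1 (closedBall a s) ∧
      (∀ x ∈ sphere a s, g1 x = g x * (x - a) ^ (-n)) ∧
      (∀ x ∈ closedBall a s', g1 x ≠ 0) ∧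
      (∀ x ∈ closedBall a s, g1 x = 0 → x ∈ T) := by
  -- lower bound for `g` off `T`
  obtain ⟨ε, hε, hεg⟩ : ∃ ε : ℝ, 0 < ε ∧ ∀ x ∈ closedBall a s \ T, ε ≤ ‖g x‖ := by
    have hK : IsCompact (closedBall a s \ T) := (isCompact_closedBall a s).diff hT
    rcases (closedBall a s \ T).eq_empty_or_nonempty with h | h
    · exact ⟨1, one_pos, by simp [h]⟩
    · obtain ⟨x, hx, hmin⟩ := hK.exists_isMinOn h (hg.norm.mono sdiff_subset)
      refine ⟨‖g x‖, ?_, fun y hy => hmin hy⟩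
      rw [norm_pos_iff]
      exact fun h => hx.2 (hz x hx.1 h)
  obtain ⟨q, hq, hqg, hq0⟩ := pp_perturb g a s s' ε hε hg
  let χ : ℂ → ℝ := fun x => max 0 (min 1 ((s - ‖x - a‖) / (s - s')))
  have hχ : Continuous χ := by
    have : s - s' ≠ 0 := by linarith
    simp only [χ]; fun_prop
  have hχ0 : ∀ x, 0 ≤ χ x := fun x => le_max_left _ _
  have hχ1 : ∀ x, χ x ≤ 1 := fun x => max_le zero_le_one (min_le_left _ _)
  have hχs : ∀ x ∈ sphere a s, χ x = 0 := by
    intro x hx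
    rw [mem_sphere, dist_eq_norm] at hx
    simp [χ, hx]
  have hχs' : ∀ x ∈ sphere a s', χ x = 1 := by
    intro x hx
    rw [mem_sphere, dist_eq_norm] at hx
    have : s - s' ≠ 0 := by linarith
    simp [χ, hx, div_self this]
  let g2 : ℂ → ℂ := fun x => g x + χ x * (q x - g x)
  have hg2 : ContinuousOn g2 (closedBall a s) := by
    have h1 : ContinuousOn (fun x => (χ x : ℂ)) (closedBall a s) := by fun_prop
    exact hg.add (h1.mul (hq.continuousOn.sub hg))
  have hg2T : ∀ x ∈ closedBall a s, g2 x = 0 → x ∈ T := by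
    intro x hx h
    by_contra hxT
    have h1 := hεg x ⟨hx, hxT⟩
    have h2 := hqg x hx
    have h3 : g x = -(χ x * (q x - g x)) := by
      simp only [g2] at h
      linear_combination h
    have h4 : ‖g x‖ = χ x * ‖q x - g x‖ := by
      conv_lhs => rw [h3]
      rw [norm_neg, norm_mul, Complex.norm_real, Real.norm_of_nonneg (hχ0 x)]
    have h5 := mul_le_mul_of_nonneg_right (hχ1 x) (norm_nonneg (q x - g x))
    linarith
  have hsub : sphere a s' ⊆ closedBall a s :=
    sphere_subset_closedBall.trans (closedBall_subset_closedBall hss.le)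
  have hg2s' : ∀ x ∈ sphere a s', g2 x ≠ 0 := by
    intro x hx
    have : g2 x = q x := by simp [g2, hχs' x hx]
    rw [this]; exact hq0 x hx
  obtain ⟨n, φ, hφ, hφg⟩ := pp_winding_circle g2 a s' hs' (hg2.mono hsub) hg2s'
  obtain ⟨Φ, hΦ, hΦφ⟩ := pp_tietze _ isClosed_sphere φ hφ
  classical
  let g1 : ℂ → ℂ := fun x => if x ∈ closedBall a s' then Complex.exp (Φ x)
    else g2 x * (x - a) ^ (-n)
  have hin : ∀ x ∈ closedBall a s', g1 x = Complex.exp (Φ x) := fun x hx => if_pos hx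
  have hout : ∀ x ∈ {x | s' ≤ dist x a}, g1 x = g2 x * (x - a) ^ (-n) := by
    intro x hx
    by_cases h : x ∈ closedBall a s'
    · have hxs : x ∈ sphere a s' := le_antisymm h hx
      have hxa : x - a ≠ 0 := by
        intro h0
        rw [mem_ofPred_eq, dist_eq_norm, h0, norm_zero] at hx
        linarith
      rw [hin x h, hφg x hxs, hΦφ x hxs, zpow_neg]
      field_simp
    · exact if_neg h
  have hne : ∀ x ∈ {x | s' ≤ dist x a}, x - a ≠ 0 := by
    intro x hx h0
    rw [mem_ofPred_eq, dist_eq_norm, h0, norm_zero] at hx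
    linarith
  refine ⟨n, g1, ?_, ?_, ?_, ?_⟩
  · have hc1 : ContinuousOn g1 (closedBall a s') :=
      (Complex.continuous_exp.comp hΦ).continuousOn.congr hin
    have hcl : IsClosed {x : ℂ | s' ≤ dist x a} :=
      isClosed_le continuous_const (by fun_prop)
    have hc2 : ContinuousOn g1 (closedBall a s ∩ {x | s' ≤ dist x a}) := by
      have h1 : ContinuousOn (fun x => (x - a) ^ (-n)) (closedBall a s ∩ {x | s' ≤ dist x a}) :=
        (by fun_prop : Continuous fun x : ℂ => x - a).continuousOn.zpow₀ _
          (fun x hx => Or.inl (hne x hx.2))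
      exact ((hg2.mono inter_subset_left).mul h1).congr (fun x hx => hout x hx.2)
    refine (hc1.union_of_isClosed hc2 isClosed_closedBall (isClosed_closedBall.inter hcl)).mono ?_
    intro x hx
    rcases le_total (dist x a) s' with h | h
    · exact Or.inl h
    · exact Or.inr ⟨hx, h⟩
  · intro x hx
    rw [hout x (by rw [mem_ofPred_eq, mem_sphere.mp hx]; exact hss.le)]
    simp [g2, hχs x hx]
  · intro x hx
    rw [hin x hx]; exact Complex.exp_ne_zero _
  · intro x hx h
    rcases le_total (dist x a) s' with h1 | h1
    · rw [hin x h1] at h; exact absurd h (Complex.exp_ne_zero _)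
    · rw [hout x h1] at h
      rcases mul_eq_zero.mp h with h2 | h2
      · exact hg2T x hx h2
      · exact absurd h2 (zpow_ne_zero _ (hne x h1))

/-- A continuous self-map `H` of the open set `W` with `H^p = id` on `W`. -/
structure PPAct (p : ℕ) (W : Set ℂ) (H : ℂ → ℂ) : Prop where
  pos : 0 < p
  isOpen : IsOpen W
  maps : MapsTo H W W
  cont : ContinuousOn H W
  per : ∀ x ∈ W, H^[p] x = x

/-- A closed disc in `W` disjoint from its translates. -/
structure PPGood (p : ℕ) (W : Set ℂ) (H : ℂ → ℂ) (a : ℂ) (s : ℝ) : Prop where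
  pos : 0 < s
  sub : closedBall a s ⊆ W
  free : ∀ i, 0 < i → i < p → ∀ x ∈ closedBall a s, H^[i] x ∉ closedBall a s

namespace PPAct

variable {p : ℕ} {W : Set ℂ} {H : ℂ → ℂ}

theorem maps_iter (h : PPAct p W H) (i : ℕ) : MapsTo H^[i] W W := h.maps.iterate i

theorem cont_iter (h : PPAct p W H) (i : ℕ) : ContinuousOn H^[i] W := h.cont.iterate h.maps i

theorem iter_mod (h : PPAct p W H) (i : ℕ) (x : ℂ) (hx : x ∈ W) : H^[i] x = H^[i % p] x :=
  (Function.IsPeriodicPt.iterate_mod_apply (h.per x hx) i).symm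

theorem inv_iter (h : PPAct p W H) (g : ℂ → ℂ) (hg : ∀ x ∈ W, g (H x) = g x) (i : ℕ) (x : ℂ)
    (hx : x ∈ W) : g (H^[i] x) = g x := by
  induction i with
  | zero => rfl
  | succ i ih => rw [Function.iterate_succ_apply', hg _ (h.maps_iter i hx), ih]

theorem uniq (h : PPAct p W H) {a : ℂ} {s : ℝ} (hd : PPGood p W H a s) (x : ℂ) (hx : x ∈ W)
    (i j : ℕ) (hi : H^[i] x ∈ closedBall a s) (hj : H^[j] x ∈ closedBall a s) :
    H^[i] x = H^[j] x := by
  wlog hij : i ≤ j generalizing i j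
  · exact (this j i hj hi (by omega)).symm
  obtain ⟨k, rfl⟩ := Nat.exists_eq_add_of_le hij
  have h1 : H^[i + k] x = H^[k % p] (H^[i] x) := by
    rw [add_comm, Function.iterate_add_apply, h.iter_mod k _ (h.maps_iter i hx)]
  rw [h1] at hj ⊢
  rcases Nat.eq_zero_or_pos (k % p) with h0 | h0
  · rw [h0]; rfl
  · exact absurd hj (hd.free _ h0 (Nat.mod_lt _ h.pos) _ hi)

theorem self_of (h : PPAct p W H) {a : ℂ} {s : ℝ} (hd : PPGood p W H a s) (x : ℂ)
    (hx : x ∈ closedBall a s) (i : ℕ) (hi : H^[i] x ∈ closedBall a s) : H^[i] x = x :=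
  h.uniq hd x (hd.sub hx) i 0 hi hx

theorem prod_inv (h : PPAct p W H) (f : ℂ → ℂ) (x : ℂ) (hx : x ∈ W) :
    ∏ i ∈ Finset.range p, f (H^[i] (H x)) = ∏ i ∈ Finset.range p, f (H^[i] x) := by
  obtain ⟨q, rfl⟩ : ∃ q, p = q + 1 := ⟨p - 1, by have := h.pos; omega⟩
  rw [Finset.prod_range_succ, Finset.prod_range_succ']
  congr 1
  have := h.per x hx
  rw [Function.iterate_succ_apply] at this
  rw [this]; rfl

theorem step (h : PPAct p W H) {a : ℂ} {s s' : ℝ} (hd : PPGood p W H a s) (hs' : 0 < s')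
    (hss : s' < s) (g : ℂ → ℂ) (hg : ContinuousOn g W) (hgi : ∀ x ∈ W, g (H x) = g x)
    (T : Set ℂ) (hT : IsOpen T) (hTi : ∀ x ∈ W, ∀ i, H^[i] x ∈ T → x ∈ T)
    (hz : ∀ x ∈ W, g x = 0 → x ∈ T) :
    ∃ (n : ℤ) (g2 : ℂ → ℂ), ContinuousOn g2 W ∧ (∀ x ∈ W, g2 (H x) = g2 x) ∧
      (∀ x ∈ W, g2 x = 0 → x ∈ T ∧ ∀ i, H^[i] x ∉ closedBall a s') ∧
      (∀ x ∈ W, (∀ i, H^[i] x ∉ ball a s) →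
        g x = g2 x * ∏ i ∈ Finset.range p, (H^[i] x - a) ^ n) := by
  obtain ⟨n, g1, hg1, hg1s, hg1n, hg1T⟩ := pp_local g a s s' hs' hss (hg.mono hd.sub) T hT
    (fun x hx => hz x (hd.sub hx))
  classical
  let N : ℂ → ℂ := fun x => ∏ i ∈ Finset.range p, (H^[i] x - a) ^ n
  let N' : ℂ → ℂ := fun x => ∏ i ∈ Finset.Ico 1 p, (H^[i] x - a) ^ n
  have hNN' : ∀ x, N x = (x - a) ^ n * N' x := by
    intro x
    simp only [N, N']
    rw [Finset.range_eq_Ico, Finset.prod_eq_prod_Ico_succ_bot h.pos]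
    simp
  have hNi : ∀ x ∈ W, N (H x) = N x := fun x hx => h.prod_inv (fun y => (y - a) ^ n) x hx
  have hain : a ∈ ball a s := mem_ball_self hd.pos
  let g2 : ℂ → ℂ := fun x => if hx : ∃ i, H^[i] x ∈ ball a s then
    g1 (H^[hx.choose] x) / N' (H^[hx.choose] x) else g x / N x
  have hin : ∀ x ∈ closedBall a s, g2 x = g1 x / N' x := by
    intro x hx
    by_cases hex : ∃ i, H^[i] x ∈ ball a s
    · simp only [g2]
      rw [dif_pos hex, h.self_of hd x hx _ (ball_subset_closedBall hex.choose_spec)]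
    · simp only [g2]
      rw [dif_neg hex]
      have hxs : x ∈ sphere a s := by
        have : x ∉ ball a s := fun hb => hex ⟨0, hb⟩
        rw [mem_ball, not_lt] at this
        exact le_antisymm hx this
      rw [hg1s x hxs, hNN', zpow_neg, ← div_div, div_eq_mul_inv (g x)]
  have hout : ∀ x, (∀ i, H^[i] x ∉ ball a s) → g2 x = g x / N x := by
    intro x hx
    simp only [g2]
    rw [dif_neg (by push Not; exact hx)]
  have hg2i : ∀ x ∈ W, g2 (H x) = g2 x := by
    intro x hx
    by_cases hex : ∃ i, H^[i] x ∈ ball a s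
    · have hex' : ∃ i, H^[i] (H x) ∈ ball a s := by
        obtain ⟨i, hi⟩ := hex
        refine ⟨i + (p - 1), ?_⟩
        rw [← Function.iterate_succ_apply, show (i + (p - 1)).succ = i + p by
          have := h.pos; omega, Function.iterate_add_apply, h.per x hx]
        exact hi
      simp only [g2]
      rw [dif_pos hex, dif_pos hex']
      have : H^[hex'.choose] (H x) = H^[hex.choose] x := by
        rw [← Function.iterate_succ_apply]
        apply h.uniq hd x hx
        · rw [Function.iterate_succ_apply]; exact ball_subset_closedBall hex'.choose_spec
        · exact ball_subset_closedBall hex.choose_spec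
      rw [this]
    · have hex' : ∀ i, H^[i] (H x) ∉ ball a s := by
        intro i hi
        exact hex ⟨i + 1, by rw [Function.iterate_succ_apply]; exact hi⟩
      rw [hout _ hex', hout x (by push Not at hex; exact hex), hgi x hx, hNi x hx]
  have hN'ne : ∀ x ∈ closedBall a s, N' x ≠ 0 := by
    intro x hx
    simp only [N']
    rw [Finset.prod_ne_zero_iff]
    intro i hi
    rw [Finset.mem_Ico] at hi
    apply zpow_ne_zero
    rw [sub_ne_zero]
    intro he
    apply hd.free i (by omega) hi.2 x hx
    rw [he]; exact ball_subset_closedBall hain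
  have hNne : ∀ x, (∀ i, H^[i] x ∉ ball a s) → N x ≠ 0 := by
    intro x hx
    simp only [N]
    rw [Finset.prod_ne_zero_iff]
    intro i _
    apply zpow_ne_zero
    rw [sub_ne_zero]
    intro he
    apply hx i
    rw [he]; exact hain
  -- the open set on which the only possible visit to the disc is at time zero
  let U0 : Set ℂ := W ∩ ⋂ i ∈ Finset.Ico 1 p, (W ∩ H^[i] ⁻¹' (closedBall a s)ᶜ)
  have hU0 : IsOpen U0 := by
    apply h.isOpen.inter
    apply isOpen_biInter_finset
    intro i _
    exact (h.cont_iter i).isOpen_inter_preimage h.isOpen isClosed_closedBall.isOpen_compl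
  have hU0W : U0 ⊆ W := inter_subset_left
  have hU0i : ∀ x ∈ U0, ∀ i, 0 < i → i < p → H^[i] x ∉ closedBall a s := by
    intro x hx i h1 h2
    have := hx.2
    simp only [mem_iInter] at this
    exact (this i (Finset.mem_Ico.mpr ⟨h1, h2⟩)).2
  have hballU0 : closedBall a s ⊆ U0 := by
    intro x hx
    refine ⟨hd.sub hx, ?_⟩
    simp only [mem_iInter]
    intro i hi
    rw [Finset.mem_Ico] at hi
    exact ⟨hd.sub hx, hd.free i (by omega) hi.2 x hx⟩
  have hU0b : ∀ x ∈ U0 \ ball a s, ∀ i, H^[i] x ∉ ball a s := by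
    intro x hx i hi
    rw [h.iter_mod i x (hU0W hx.1)] at hi
    rcases Nat.eq_zero_or_pos (i % p) with h0 | h0
    · rw [h0] at hi; exact hx.2 hi
    · exact hU0i x hx.1 _ h0 (Nat.mod_lt _ h.pos) (ball_subset_closedBall hi)
  have hcU0 : ∀ x ∈ U0, ContinuousAt g2 x := by
    have hA : ContinuousOn g2 (closedBall a s) := by
      refine ContinuousOn.congr (f := fun x => g1 x / N' x) ?_ hin
      refine hg1.div ?_ hN'ne
      apply continuousOn_finsetProd
      intro i hi
      refine (((h.cont_iter i).mono hd.sub).sub continuousOn_const).zpow₀ _ ?_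
      intro x hx
      left
      change H^[i] x - a ≠ 0
      rw [sub_ne_zero]
      intro he
      rw [Finset.mem_Ico] at hi
      apply hd.free i (by omega) hi.2 x hx
      rw [he]; exact ball_subset_closedBall hain
    have hB : ContinuousOn g2 (U0 \ ball a s) := by
      refine ContinuousOn.congr (f := fun x => g x / N x) ?_ (fun x hx => hout x (hU0b x hx))
      have hsub : U0 \ ball a s ⊆ W := fun x hx => hU0W hx.1
      refine (hg.mono hsub).div ?_ (fun x hx => hNne x (hU0b x hx))
      apply continuousOn_finsetProd
      intro i hi
      refine (((h.cont_iter i).mono hsub).sub continuousOn_const).zpow₀ _ ?_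
      intro x hx
      left
      change H^[i] x - a ≠ 0
      rw [sub_ne_zero]
      intro he
      apply hU0b x hx i
      rw [he]; exact hain
    intro x hx
    have hA' : ContinuousWithinAt g2 (closedBall a s) x := by
      by_cases hxc : x ∈ closedBall a s
      · exact hA x hxc
      · apply continuousWithinAt_of_notMem_closure
        rwa [isClosed_closedBall.closure_eq]
    have hB' : ContinuousWithinAt g2 (U0 \ ball a s) x := by
      by_cases hxc : x ∈ ball a s
      · apply continuousWithinAt_of_notMem_closure
        intro hcl
        have h2 : closure (U0 \ ball a s) ⊆ (ball a s)ᶜ :=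
          closure_minimal (fun y hy => hy.2) isOpen_ball.isClosed_compl
        exact h2 hcl hxc
      · exact hB x ⟨hx, hxc⟩
    refine (hA'.union hB').continuousAt ?_
    filter_upwards [hU0.mem_nhds hx] with y hy
    by_cases hyc : y ∈ ball a s
    · exact Or.inl (ball_subset_closedBall hyc)
    · exact Or.inr ⟨hy, hyc⟩
  have hreach : ∀ x ∈ W, ∃ i, H^[i] x ∈ U0 := by
    intro x hx
    by_cases hex : ∃ i, H^[i] x ∈ closedBall a s
    · obtain ⟨i, hi⟩ := hex
      exact ⟨i, hballU0 hi⟩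
    · push Not at hex
      refine ⟨0, hx, ?_⟩
      simp only [mem_iInter]
      intro i _
      exact ⟨hx, hex i⟩
  refine ⟨n, g2, ?_, hg2i, ?_, ?_⟩
  · intro x hx
    apply ContinuousAt.continuousWithinAt
    obtain ⟨i, hi⟩ := hreach x hx
    have h1 : ContinuousAt (g2 ∘ H^[i]) x :=
      ContinuousAt.comp (hcU0 _ hi) ((h.cont_iter i).continuousAt (h.isOpen.mem_nhds hx))
    refine h1.congr ?_
    filter_upwards [h.isOpen.mem_nhds hx] with y hy
    exact h.inv_iter g2 hg2i i y hy
  · intro x hx h0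
    by_cases hex : ∃ i, H^[i] x ∈ closedBall a s
    · obtain ⟨i, hi⟩ := hex
      rw [← h.inv_iter g2 hg2i i x hx, hin _ hi, div_eq_zero_iff,
        or_iff_left (hN'ne _ hi)] at h0
      refine ⟨hTi x hx i (hg1T _ hi h0), fun j hj => ?_⟩
      have : H^[j] x = H^[i] x :=
        h.uniq hd x hx j i (closedBall_subset_closedBall hss.le hj) hi
      rw [this] at hj
      exact hg1n _ hj h0
    · push Not at hex
      have hb : ∀ i, H^[i] x ∉ ball a s := fun i hi => hex i (ball_subset_closedBall hi)
      rw [hout x hb, div_eq_zero_iff, or_iff_left (hNne x hb)] at h0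
      exact ⟨hz x hx h0, fun i hi => hex i (closedBall_subset_closedBall hss.le hi)⟩
  · intro x hx hb
    rw [hout x hb]
    exact (div_mul_cancel₀ _ (hNne x hb)).symm

theorem core (h : PPAct p W H) {ρ ρ1 : ℝ} (hρ : 0 < ρ) (hρW : closedBall 0 ρ ⊆ W)
    (ho : ∀ x ∈ sphere (0 : ℂ) ρ, ∀ i, ρ1 < ‖H^[i] x‖ ∧ ‖H^[i] x - x‖ < ‖x‖)
    (l : List (ℂ × ℝ))
    (hl : ∀ d ∈ l, PPGood p W H d.1 d.2 ∧ closedBall d.1 d.2 ⊆ ball 0 ρ1)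
    (g : ℂ → ℂ) (hg : ContinuousOn g W) (hgi : ∀ x ∈ W, g (H x) = g x)
    (hz : ∀ x ∈ W, g x = 0 → ∃ d ∈ l, ∃ i, H^[i] x ∈ ball d.1 (d.2 / 2)) :
    ∃ (k : ℤ) (φ : ℂ → ℂ), ContinuousOn φ (sphere 0 ρ) ∧
      ∀ x ∈ sphere (0 : ℂ) ρ, g x = x ^ (p * k : ℤ) * Complex.exp (φ x) := by
  have hsW : sphere (0 : ℂ) ρ ⊆ W := sphere_subset_closedBall.trans hρW
  induction l generalizing g with
  | nil =>
    obtain ⟨φ, hφ, hφg⟩ := pp_log_ball g 0 ρ hρ (hg.mono hρW)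
      (fun x hx h0 => by simpa using hz x (hρW hx) h0)
    refine ⟨0, φ, hφ.continuousOn, fun x hx => ?_⟩
    simp [hφg x (sphere_subset_closedBall hx)]
  | cons d l ih =>
    obtain ⟨⟨hd, hdρ⟩, hl'⟩ := List.forall_mem_cons.mp hl
    obtain ⟨a, s⟩ := d
    simp only at hd hdρ
    let T : Set ℂ := ⋃ d ∈ (a, s) :: l, ⋃ i : ℕ, (W ∩ H^[i] ⁻¹' (ball d.1 (d.2 / 2)))
    have hTmem : ∀ x, x ∈ T ↔ x ∈ W ∧ ∃ d ∈ (a, s) :: l, ∃ i, H^[i] x ∈ ball d.1 (d.2 / 2) := by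
      intro x
      simp only [T, mem_iUnion, mem_inter_iff, mem_preimage]
      constructor
      · rintro ⟨d, hd, i, h1, h2⟩
        exact ⟨h1, d, hd, i, h2⟩
      · rintro ⟨h1, d, hd, i, h2⟩
        exact ⟨d, hd, i, h1, h2⟩
    have hTo : IsOpen T := by
      apply isOpen_biUnion
      intro d _
      apply isOpen_iUnion
      intro i
      exact (h.cont_iter i).isOpen_inter_preimage h.isOpen isOpen_ball
    obtain ⟨n, g2, hg2, hg2i, hg2z, hg2g⟩ := h.step hd (half_pos hd.pos) (half_lt_self hd.pos)
      g hg hgi T hTo (by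
        intro x hx i hi
        rw [hTmem] at hi ⊢
        obtain ⟨-, d, hd, j, hj⟩ := hi
        rw [← Function.iterate_add_apply] at hj
        exact ⟨hx, d, hd, j + i, hj⟩) (by
        intro x hx h0
        rw [hTmem]
        exact ⟨hx, hz x hx h0⟩)
    obtain ⟨k, φ, hφ, hφg⟩ := ih hl' g2 hg2 hg2i (by
      intro x hx h0
      obtain ⟨h1, h2⟩ := hg2z x hx h0
      rw [hTmem] at h1
      obtain ⟨-, d, hd, i, hi⟩ := h1
      rcases List.mem_cons.mp hd with rfl | hd
      · exact absurd (ball_subset_closedBall hi) (h2 i)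
      · exact ⟨d, hd, i, hi⟩)
    have haρ : ‖a‖ < ρ1 := by
      have := hdρ (mem_closedBall_self hd.pos.le)
      simpa using this
    let ψ : ℕ → ℂ → ℂ := fun i x =>
      Complex.log (1 + -(a / H^[i] x)) + Complex.log (1 + (H^[i] x - x) / x)
    have hx0 : ∀ x ∈ sphere (0 : ℂ) ρ, x ≠ 0 := fun x hx => by
      rintro rfl; simp at hx; linarith
    have hHx0 : ∀ x ∈ sphere (0 : ℂ) ρ, ∀ i, H^[i] x ≠ 0 := fun x hx i h0 => by
      have := (ho x hx i).1
      rw [h0, norm_zero] at this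
      linarith [norm_nonneg a]
    have hs1 : ∀ x ∈ sphere (0 : ℂ) ρ, ∀ i, 1 + -(a / H^[i] x) ∈ Complex.slitPlane := by
      intro x hx i
      apply Complex.mem_slitPlane_of_norm_lt_one
      rw [norm_neg, norm_div, div_lt_one (norm_pos_iff.mpr (hHx0 x hx i))]
      exact haρ.trans (ho x hx i).1
    have hs2 : ∀ x ∈ sphere (0 : ℂ) ρ, ∀ i, 1 + (H^[i] x - x) / x ∈ Complex.slitPlane := by
      intro x hx i
      apply Complex.mem_slitPlane_of_norm_lt_one
      rw [norm_div, div_lt_one (norm_pos_iff.mpr (hx0 x hx))]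
      exact (ho x hx i).2
    have hψ : ∀ i, ContinuousOn (ψ i) (sphere 0 ρ) := by
      intro i
      have hc := (h.cont_iter i).mono hsW
      refine ContinuousOn.add ?_ ?_
      · refine ContinuousOn.clog ?_ (fun x hx => hs1 x hx i)
        exact continuousOn_const.add (continuousOn_const.div hc (fun x hx => hHx0 x hx i)).neg
      · refine ContinuousOn.clog ?_ (fun x hx => hs2 x hx i)
        exact continuousOn_const.add ((hc.sub continuousOn_id).div continuousOn_id hx0)
    have hψe : ∀ x ∈ sphere (0 : ℂ) ρ, ∀ i, H^[i] x - a = x * Complex.exp (ψ i x) := by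
      intro x hx i
      simp only [ψ]
      rw [Complex.exp_add, Complex.exp_log (Complex.slitPlane_ne_zero (hs1 x hx i)),
        Complex.exp_log (Complex.slitPlane_ne_zero (hs2 x hx i))]
      have h1 := hx0 x hx
      have h2 := hHx0 x hx i
      field_simp
      ring
    refine ⟨k + n, fun x => φ x + ∑ i ∈ Finset.range p, n * ψ i x, ?_, ?_⟩
    · refine hφ.add ?_
      apply continuousOn_finsetSum
      intro i _
      exact continuousOn_const.mul (hψ i)
    · intro x hx
      rw [hg2g x (hsW hx), hφg x hx, Complex.exp_add, Complex.exp_sum, mul_add,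
        zpow_add₀ (hx0 x hx)]
      · have : ∏ i ∈ Finset.range p, (H^[i] x - a) ^ n =
            x ^ ((p : ℤ) * n) * ∏ i ∈ Finset.range p, Complex.exp (n * ψ i x) := by
          rw [mul_comm (p : ℤ) n, zpow_mul, zpow_natCast]
          conv_rhs => rw [← Finset.card_range p, ← Finset.prod_const, Finset.card_range,
            ← Finset.prod_mul_distrib]
          apply Finset.prod_congr rfl
          intro i _
          rw [hψe x hx i, mul_zpow, Complex.exp_int_mul]
        rw [this]; ring
      · intro i hi
        have h1 := (ho x hx i).1
        have h2 := hdρ (ball_subset_closedBall hi)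
        rw [mem_ball_zero_iff] at h2
        linarith

end PPAct

theorem pp_enlarge (r : ℝ) (hr : 0 < r) (U : Set ℂ) (hU : IsOpen U)
    (h : closedBall (0 : ℂ) r ⊆ U) : ∃ ρ, r < ρ ∧ closedBall (0 : ℂ) ρ ⊆ U := by
  obtain ⟨δ, hδ, hsub⟩ := (isCompact_closedBall (0 : ℂ) r).exists_cthickening_subset_open hU h
  rw [cthickening_closedBall hδ.le hr.le] at hsub
  exact ⟨δ + r, by linarith, hsub⟩

namespace PPAct

variable {p : ℕ} {W : Set ℂ} {H : ℂ → ℂ}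

theorem sum_inv (h : PPAct p W H) (f : ℂ → ℂ) (x : ℂ) (hx : x ∈ W) :
    ∑ i ∈ Finset.range p, f (H^[i] (H x)) = ∑ i ∈ Finset.range p, f (H^[i] x) := by
  obtain ⟨q, rfl⟩ : ∃ q, p = q + 1 := ⟨p - 1, by have := h.pos; omega⟩
  rw [Finset.sum_range_succ, Finset.sum_range_succ']
  congr 1
  have := h.per x hx
  rw [Function.iterate_succ_apply] at this
  rw [this]; rfl

theorem return_iter (h : PPAct p W H) (i : ℕ) (x : ℂ) (hx : x ∈ W) :
    ∃ j, H^[j] (H^[i] x) = x := by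
  refine ⟨p - i % p, ?_⟩
  rw [h.iter_mod i x hx, ← Function.iterate_add_apply,
    Nat.sub_add_cancel (Nat.mod_lt _ h.pos).le, h.per x hx]

/-- The geometric mean of the orbit. -/
noncomputable def gmean (p : ℕ) (H : ℂ → ℂ) (x : ℂ) : ℂ :=
  x * Complex.exp ((1 / p : ℂ) * ∑ i ∈ Finset.range p, Complex.log (H^[i] x / x))

theorem gmean_fixed (x : ℂ) (hx : H x = x) : gmean p H x = x := by
  unfold gmean
  rcases eq_or_ne x 0 with rfl | h0
  · simp
  · have : ∀ i, H^[i] x = x := fun i => Function.iterate_fixed hx i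
    simp [this, div_self h0]

theorem gmean_facts (h : PPAct p W H)
    (hq : ∀ x ∈ W, x ≠ 0 → ∀ i, ‖H^[i] x / x - 1‖ < 1)
    (hne : ∀ x ∈ W, x ≠ 0 → H x ≠ 0)
    {r : ℝ} (hr : 0 < r) (hrf : ∀ x ∈ closedBall (0 : ℂ) r, H x = x) :
    ContinuousOn (gmean p H) W ∧ (∀ x ∈ W, gmean p H (H x) = gmean p H x) ∧
    (∀ x ∈ W, x ≠ 0 → gmean p H x ^ p = ∏ i ∈ Finset.range p, H^[i] x) := by
  have hp0 : (p : ℂ) ≠ 0 := by exact_mod_cast h.pos.ne'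
  have hHi : ∀ x ∈ W, x ≠ 0 → ∀ i, H^[i] x ≠ 0 := by
    intro x hx h0 i
    induction i with
    | zero => exact h0
    | succ i ih => rw [Function.iterate_succ_apply']; exact hne _ (h.maps_iter i hx) ih
  have hre : ∀ x ∈ W, x ≠ 0 → ∀ i, 0 < (H^[i] x / x).re := by
    intro x hx h0 i
    have h1 := (Complex.abs_re_le_norm _).trans_lt (hq x hx h0 i)
    rw [Complex.sub_re, Complex.one_re, abs_lt] at h1
    linarith
  refine ⟨?_, ?_, ?_⟩
  · intro x hx
    apply ContinuousAt.continuousWithinAt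
    rcases eq_or_ne x 0 with rfl | h0
    · have : gmean p H =ᶠ[𝓝 0] id := by
        filter_upwards [closedBall_mem_nhds (0 : ℂ) hr] with y hy
        exact gmean_fixed y (hrf y hy)
      exact continuousAt_id.congr this.symm
    · unfold gmean
      refine continuousAt_id.mul (ContinuousAt.cexp (continuousAt_const.mul ?_))
      apply tendsto_finsetSum
      intro i _
      refine ContinuousAt.clog ?_ (Or.inl (hre x hx h0 i))
      exact ((h.cont_iter i).continuousAt (h.isOpen.mem_nhds hx)).div continuousAt_id h0
  · intro x hx
    rcases eq_or_ne x 0 with rfl | h0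
    · rw [hrf 0 (mem_closedBall_self hr.le)]
    · have hHx := hne x hx h0
      have hHW := h.maps hx
      have h1 : ∀ i, Complex.log (H^[i] (H x) / x) =
          Complex.log (H^[i] (H x) / H x) + Complex.log (H x / x) := by
        intro i
        have ha := hre (H x) hHW hHx i
        have hb := hre x hx h0 1
        simp only [Function.iterate_one] at hb
        have ha' := abs_lt.mp (Complex.abs_arg_lt_pi_div_two_iff.mpr (Or.inl ha))
        have hb' := abs_lt.mp (Complex.abs_arg_lt_pi_div_two_iff.mpr (Or.inl hb))
        rw [← Complex.log_mul (div_ne_zero (hHi _ hHW hHx i) hHx) (div_ne_zero hHx h0)]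
        · congr 1
          field_simp
        · constructor <;> linarith
      have h2 : ∑ i ∈ Finset.range p, Complex.log (H^[i] x / x) =
          ∑ i ∈ Finset.range p, Complex.log (H^[i] (H x) / H x) + p * Complex.log (H x / x) := by
        rw [← h.sum_inv (fun y => Complex.log (y / x)) x hx, Finset.sum_congr rfl
          (fun i _ => h1 i), Finset.sum_add_distrib]
        simp
      unfold gmean
      rw [h2, mul_add, Complex.exp_add, ← mul_assoc (1 / (p : ℂ)) p, one_div_mul_cancel hp0,
        one_mul, Complex.exp_log (div_ne_zero hHx h0)]
      field_simp
  · intro x hx h0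
    unfold gmean
    rw [mul_pow, ← Complex.exp_nat_mul, ← mul_assoc, mul_one_div_cancel hp0, one_mul,
      Complex.exp_sum]
    conv_lhs => rw [← Finset.card_range p, ← Finset.prod_const, Finset.card_range,
            ← Finset.prod_mul_distrib]
    apply Finset.prod_congr rfl
    intro i _
    rw [Complex.exp_log (div_ne_zero (hHi x hx h0 i) h0)]
    field_simp

theorem exists_good (h : PPAct p W H) (hp : p.Prime) (x : ℂ) (hx : x ∈ W) (hHx : H x ≠ x)
    (V : Set ℂ) (hV : V ∈ 𝓝 x) : ∃ s, PPGood p W H x s ∧ closedBall x s ⊆ V := by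
  have hfree : ∀ i ∈ Finset.Ico 1 p, H^[i] x ≠ x := by
    intro i hi he
    rw [Finset.mem_Ico] at hi
    apply hHx
    have h1 : Function.IsPeriodicPt H (Nat.gcd i p) x :=
      Function.IsPeriodicPt.gcd he (h.per x hx)
    have h2 : Nat.gcd i p = 1 :=
      Nat.Coprime.symm ((Nat.Prime.coprime_iff_not_dvd hp).mpr
        (fun hd => absurd (Nat.le_of_dvd (by omega) hd) (by omega)))
    rw [h2] at h1
    exact h1
  have hn : ∀ i ∈ Finset.Ico 1 p, ∃ u ∈ 𝓝 x, ∀ y ∈ u, H^[i] y ∉ u := by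
    intro i hi
    obtain ⟨u, v, hu, hv, hxu, hxv, huv⟩ := t2_separation (hfree i hi)
    refine ⟨v ∩ H^[i] ⁻¹' u, Filter.inter_mem (hv.mem_nhds hxv) ?_, ?_⟩
    · exact ((h.cont_iter i).continuousAt (h.isOpen.mem_nhds hx)) (hu.mem_nhds hxu)
    · intro y hy hy'
      exact huv.ne_of_mem hy.2 hy'.1 rfl
  choose! u hu hu' using hn
  have hN : V ∩ W ∩ ⋂ i ∈ Finset.Ico 1 p, u i ∈ 𝓝 x :=
    Filter.inter_mem (Filter.inter_mem hV (h.isOpen.mem_nhds hx))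
      ((Filter.biInter_finset_mem _).mpr hu)
  obtain ⟨s, hs, hsub⟩ := nhds_basis_closedBall.mem_iff.mp hN
  refine ⟨s, ⟨hs, fun y hy => (hsub hy).1.2, ?_⟩, fun y hy => (hsub hy).1.1⟩
  intro i hi hip y hy hy'
  have hm : i ∈ Finset.Ico 1 p := Finset.mem_Ico.mpr ⟨hi, hip⟩
  have h1 := (hsub hy).2
  have h2 := (hsub hy').2
  simp only [mem_iInter] at h1 h2
  exact hu' i hm y (h1 i hm) (h2 i hm)

theorem shrink (h : PPAct p W H) (V : Set ℂ) (hV : IsOpen V) :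
    PPAct p (W ∩ ⋂ i ∈ Finset.range p, (W ∩ H^[i] ⁻¹' V)) H ∧
    ∀ x ∈ (W ∩ ⋂ i ∈ Finset.range p, (W ∩ H^[i] ⁻¹' V)), ∀ i, H^[i] x ∈ V := by
  have key : ∀ x ∈ (W ∩ ⋂ i ∈ Finset.range p, (W ∩ H^[i] ⁻¹' V)), ∀ i, H^[i] x ∈ V := by
    intro x hx i
    have h1 := hx.2
    simp only [mem_iInter] at h1
    rw [h.iter_mod i x hx.1]
    exact (h1 _ (Finset.mem_range.mpr (Nat.mod_lt _ h.pos))).2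
  refine ⟨⟨h.pos, ?_, ?_, h.cont.mono inter_subset_left, fun x hx => h.per x hx.1⟩, key⟩
  · apply h.isOpen.inter
    apply isOpen_biInter_finset
    intro i _
    exact (h.cont_iter i).isOpen_inter_preimage h.isOpen hV
  · intro x hx
    refine ⟨h.maps hx.1, ?_⟩
    simp only [mem_iInter]
    intro i _
    refine ⟨h.maps hx.1, ?_⟩
    rw [mem_preimage, ← Function.iterate_succ_apply]
    exact key x hx _

theorem newman_prime (h : PPAct p W H) (hp : p.Prime) {r : ℝ} (hr : 0 < r)
    (hrW : closedBall (0 : ℂ) r ⊆ W) (hrf : ∀ x ∈ closedBall (0 : ℂ) r, H x = x) :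
    ∃ ρ, r < ρ ∧ ∀ x ∈ ball (0 : ℂ) ρ, H x = x := by
  have hrfi : ∀ x ∈ closedBall (0 : ℂ) r, ∀ i, H^[i] x = x :=
    fun x hx i => Function.iterate_fixed (hrf x hx) i
  -- shrink `W` so that orbits are small
  let V : Set ℂ := W ∩ ⋂ i ∈ Finset.range p, (W ∩ (fun x => H^[i] x - x) ⁻¹' (ball 0 r))
  have hV : IsOpen V := by
    apply h.isOpen.inter
    apply isOpen_biInter_finset
    intro i _
    exact ((h.cont_iter i).sub continuousOn_id).isOpen_inter_preimage h.isOpen isOpen_ball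
  obtain ⟨h0, hW0V⟩ := h.shrink V hV
  set W0 : Set ℂ := W ∩ ⋂ i ∈ Finset.range p, (W ∩ H^[i] ⁻¹' V) with hW0
  have hVsub : closedBall (0 : ℂ) r ⊆ V := by
    intro x hx
    refine ⟨hrW hx, ?_⟩
    simp only [mem_iInter]
    intro i _
    refine ⟨hrW hx, ?_⟩
    simp [hrfi x hx i, hr]
  have hrW0 : closedBall (0 : ℂ) r ⊆ W0 := by
    intro x hx
    refine ⟨hrW hx, ?_⟩
    simp only [mem_iInter]
    intro i _
    refine ⟨hrW hx, ?_⟩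
    rw [mem_preimage, hrfi x hx i]
    exact hVsub hx
  have hsmall : ∀ x ∈ W0, ∀ i, ‖H^[i] x - x‖ < r := by
    intro x hx i
    have h1 := (hW0V x hx 0).2
    simp only [mem_iInter] at h1
    have h2 := (h1 _ (Finset.mem_range.mpr (Nat.mod_lt i h.pos))).2
    rw [h0.iter_mod i x hx]
    simpa using h2
  -- points outside the fixed disc stay outside
  have hstay : ∀ x ∈ W0, x ∉ closedBall (0 : ℂ) r → ∀ i, r < ‖H^[i] x‖ := by
    intro x hx hxr i
    by_contra hle
    rw [not_lt] at hle
    have hm : H^[i] x ∈ closedBall (0 : ℂ) r := by simpa using hle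
    obtain ⟨j, hj⟩ := h0.return_iter i x hx
    rw [hrfi _ hm j] at hj
    rw [hj] at hm
    exact hxr hm
  have hq : ∀ x ∈ W0, x ≠ 0 → ∀ i, ‖H^[i] x / x - 1‖ < 1 := by
    intro x hx hx0 i
    by_cases hxr : x ∈ closedBall (0 : ℂ) r
    · rw [hrfi x hxr i, div_self hx0]; simp
    · rw [div_sub_one hx0, norm_div, div_lt_one (norm_pos_iff.mpr hx0)]
      exact (hsmall x hx i).trans (hstay x hx hxr 0)
  have hne : ∀ x ∈ W0, x ≠ 0 → H x ≠ 0 := by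
    intro x hx hx0 hH
    by_cases hxr : x ∈ closedBall (0 : ℂ) r
    · rw [hrf x hxr] at hH; exact hx0 hH
    · have := hstay x hx hxr 1
      simp only [Function.iterate_one, hH, norm_zero] at this
      linarith
  obtain ⟨hAc, hAi, hAp⟩ := h0.gmean_facts hq hne hr hrf
  -- radii
  obtain ⟨ρ, hρr, hρW⟩ := pp_enlarge r hr W0 h0.isOpen hrW0
  obtain ⟨h1, hW1⟩ := h0.shrink (ball 0 ρ) isOpen_ball
  obtain ⟨ρ1, hρ1r, hρ1W⟩ := pp_enlarge r hr _ h1.isOpen (by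
    intro x hx
    refine ⟨hrW0 hx, ?_⟩
    simp only [mem_iInter]
    intro i _
    refine ⟨hrW0 hx, ?_⟩
    rw [mem_preimage, hrfi x hx i]
    exact closedBall_subset_ball hρr hx)
  have hρ0 : 0 < ρ := hr.trans hρr
  have ho : ∀ x ∈ sphere (0 : ℂ) ρ, ∀ i, ρ1 < ‖H^[i] x‖ ∧ ‖H^[i] x - x‖ < ‖x‖ := by
    intro x hx i
    have hxW := hρW (sphere_subset_closedBall hx)
    have hxn : ‖x‖ = ρ := by simpa using hx
    refine ⟨?_, by rw [hxn]; exact (hsmall x hxW i).trans hρr⟩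
    by_contra hle
    rw [not_lt] at hle
    have hm : H^[i] x ∈ closedBall (0 : ℂ) ρ1 := by simpa using hle
    obtain ⟨j, hj⟩ := h0.return_iter i x hxW
    have := hW1 _ (hρ1W hm) j
    rw [hj, mem_ball_zero_iff, hxn] at this
    exact lt_irrefl _ this
  by_contra hcon
  push Not at hcon
  -- a non-fixed point `z` very close to the disc
  obtain ⟨ρ', hρ'r, hρ'1, hρ'2⟩ : ∃ ρ', r < ρ' ∧ ρ' < ρ1 ∧ ρ' ^ p < ρ1 * r ^ (p - 1) := by
    have hc : ContinuousAt (fun t : ℝ => t ^ p) r := by fun_prop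
    have hlt : r ^ p < ρ1 * r ^ (p - 1) := by
      conv_lhs => rw [show p = (p - 1) + 1 by have := h.pos; omega, pow_succ']
      exact mul_lt_mul_of_pos_right hρ1r (by positivity)
    have he : ∀ᶠ t in 𝓝[>] r, t ^ p < ρ1 * r ^ (p - 1) :=
      (hc.eventually_lt continuousAt_const hlt).filter_mono nhdsWithin_le_nhds
    have he2 : ∀ᶠ t in 𝓝[>] r, t ∈ Ioo r ρ1 := Ioo_mem_nhdsGT hρ1r
    obtain ⟨t, ht1, ht2⟩ := (he.and he2).exists
    exact ⟨t, ht2.1, ht2.2, ht1⟩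
  obtain ⟨z, hz, hzf⟩ := hcon ρ' hρ'r
  rw [mem_ball_zero_iff] at hz
  have hzτ : ‖z‖ ^ p < ρ1 * r ^ (p - 1) :=
    (pow_le_pow_left₀ (norm_nonneg z) hz.le p).trans_lt hρ'2
  let g : ℂ → ℂ := fun x => gmean p H x - z
  have hgc : ContinuousOn g W0 := hAc.sub continuousOn_const
  have hgi : ∀ x ∈ W0, g (H x) = g x := fun x hx => by simp only [g]; rw [hAi x hx]
  have hzero : ∀ x ∈ W0, g x = 0 → H x ≠ x ∧
      x ∈ closedBall (0 : ℂ) (‖z‖ ^ p / r ^ (p - 1)) := by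
    intro x hx hx0
    have hAz : gmean p H x = z := sub_eq_zero.mp hx0
    have hf : H x ≠ x := by
      intro hf
      rw [gmean_fixed x hf] at hAz
      rw [hAz] at hf
      exact hzf hf
    refine ⟨hf, ?_⟩
    have hxr : x ∉ closedBall (0 : ℂ) r := fun hm => hf (hrf x hm)
    have hxne : x ≠ 0 := by
      rintro rfl
      exact hxr (mem_closedBall_self hr.le)
    have hP := hAp x hx hxne
    rw [hAz] at hP
    have hPn := congrArg norm hP
    rw [norm_pow, norm_prod] at hPn
    have hge : r ^ (p - 1) * ‖x‖ ≤ ∏ i ∈ Finset.range p, ‖H^[i] x‖ := by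
      conv_rhs => rw [show p = (p - 1) + 1 by have := h.pos; omega, Finset.prod_range_succ']
      refine mul_le_mul_of_nonneg_right ?_ (norm_nonneg _)
      calc r ^ (p - 1) = ∏ _i ∈ Finset.range (p - 1), r := by simp
        _ ≤ _ := Finset.prod_le_prod (fun _ _ => hr.le) (fun i _ => (hstay x hx hxr _).le)
    rw [mem_closedBall_zero_iff, le_div_iff₀ (by positivity)]
    linarith
  have hτ : ‖z‖ ^ p / r ^ (p - 1) < ρ1 := by
    rw [div_lt_iff₀ (by positivity)]; exact hzτ
  have hτW : closedBall (0 : ℂ) (‖z‖ ^ p / r ^ (p - 1)) ⊆ W0 := fun x hx =>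
    (hρ1W (closedBall_subset_closedBall hτ.le hx)).1
  let K : Set ℂ := closedBall (0 : ℂ) (‖z‖ ^ p / r ^ (p - 1)) ∩ g ⁻¹' {0}
  have hK : IsCompact K := by
    apply (isCompact_closedBall _ _).of_isClosed_subset _ inter_subset_left
    exact (hgc.mono hτW).preimage_isClosed_of_isClosed isClosed_closedBall isClosed_singleton
  have hgood : ∀ x ∈ K, ∃ s, PPGood p W0 H x s ∧ closedBall x s ⊆ ball 0 ρ1 := by
    intro x hx
    exact h0.exists_good hp x (hτW hx.1) (hzero x (hτW hx.1) hx.2).1 _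
      (isOpen_ball.mem_nhds (closedBall_subset_ball hτ hx.1))
  choose! s hs hsρ using hgood
  obtain ⟨t, htK, htc⟩ := hK.elim_nhds_subcover (fun x => ball x (s x / 2))
    (fun x hx => ball_mem_nhds _ (half_pos (hs x hx).pos))
  obtain ⟨k, φ, hφ, hφg⟩ := h0.core hρ0 hρW ho (t.toList.map (fun x => (x, s x))) (by
      intro d hd
      rw [List.mem_map] at hd
      obtain ⟨x, hx, rfl⟩ := hd
      rw [Finset.mem_toList] at hx
      exact ⟨hs x (htK x hx), hsρ x (htK x hx)⟩) g hgc hgi (by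
      intro x hx hx0
      have hxK : x ∈ K := ⟨(hzero x hx hx0).2, hx0⟩
      have := htc hxK
      simp only [mem_iUnion] at this
      obtain ⟨y, hy, hxy⟩ := this
      exact ⟨(y, s y), List.mem_map.mpr ⟨y, Finset.mem_toList.mpr hy, rfl⟩, 0, hxy⟩)
  -- but the winding number is one
  have hsW : sphere (0 : ℂ) ρ ⊆ W0 := sphere_subset_closedBall.trans hρW
  have hx0 : ∀ x ∈ sphere (0 : ℂ) ρ, x ≠ 0 := fun x hx => by
    rintro rfl; simp at hx; linarith
  have hAbig : ∀ x ∈ sphere (0 : ℂ) ρ, ‖z‖ < ‖gmean p H x‖ := by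
    intro x hx
    have hP := congrArg norm (hAp x (hsW hx) (hx0 x hx))
    rw [norm_pow, norm_prod] at hP
    have hge : ρ1 ^ p ≤ ‖gmean p H x‖ ^ p := by
      rw [hP]
      calc ρ1 ^ p = ∏ _i ∈ Finset.range p, ρ1 := by simp
        _ ≤ _ := Finset.prod_le_prod (fun _ _ => by linarith) (fun i _ => (ho x hx i).1.le)
    have := le_of_pow_le_pow_left₀ h.pos.ne' (norm_nonneg _) hge
    linarith
  let S : ℂ → ℂ := fun x => (1 / p : ℂ) * ∑ i ∈ Finset.range p, Complex.log (H^[i] x / x)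
  have hS : ContinuousOn S (sphere 0 ρ) := by
    refine continuousOn_const.mul ?_
    apply continuousOn_finsetSum
    intro i _
    refine ContinuousOn.clog (((h0.cont_iter i).mono hsW).div continuousOn_id hx0) ?_
    intro x hx
    have := Complex.mem_slitPlane_of_norm_lt_one (hq x (hsW hx) (hx0 x hx) i)
    simpa using this
  have hA0 : ∀ x ∈ sphere (0 : ℂ) ρ, gmean p H x ≠ 0 := fun x hx =>
    norm_pos_iff.mp ((norm_nonneg z).trans_lt (hAbig x hx))
  have hs3 : ∀ x ∈ sphere (0 : ℂ) ρ, 1 + -(z / gmean p H x) ∈ Complex.slitPlane := by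
    intro x hx
    apply Complex.mem_slitPlane_of_norm_lt_one
    rw [norm_neg, norm_div, div_lt_one (norm_pos_iff.mpr (hA0 x hx))]
    exact hAbig x hx
  have hfin := pp_winding_unique (p * k - 1) ρ hρ0
    (fun x => S x + Complex.log (1 + -(z / gmean p H x)) - φ x) (by
      refine (hS.add (ContinuousOn.clog ?_ hs3)).sub hφ
      exact continuousOn_const.add (continuousOn_const.div (hAc.mono hsW) hA0).neg) (by
      intro x hx
      have e1 := hφg x hx
      have e2 : g x = x * Complex.exp (S x) * (1 + -(z / gmean p H x)) := by
        have : gmean p H x = x * Complex.exp (S x) := rfl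
        rw [← this]
        simp only [g]
        have := hA0 x hx
        field_simp
        ring
      rw [Complex.exp_sub, Complex.exp_add,
        Complex.exp_log (Complex.slitPlane_ne_zero (hs3 x hx)), zpow_sub_one₀ (hx0 x hx)]
      rw [e1] at e2
      have h3 := hx0 x hx
      have h4 := Complex.exp_ne_zero (φ x)
      rw [eq_div_iff h4, mul_assoc, mul_comm x⁻¹, ← mul_assoc, e2]
      field_simp)
  have h2 := hp.two_le
  have hdvd : (p : ℤ) ∣ 1 := ⟨k, by linarith⟩
  have := Int.le_of_dvd one_pos hdvd
  omega

end PPAct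

theorem pp_fix_of_int {X : Type*} [TopologicalSpace X] {f : X → X} {x : X}
    (h : x ∈ interior {x | f x = x}) : f x = x := by
  have h2 := interior_subset h
  exact h2

theorem pp_openMap_iterate {X : Type*} [TopologicalSpace X] {f : X → X} (hf : IsOpenMap f) (n : ℕ) :
    IsOpenMap f^[n] := by
  induction n with
  | zero => exact IsOpenMap.id
  | succ n ih => exact ih.comp hf

theorem pp_iter_open (H : ℂ → ℂ) (W : Set ℂ) (hW : IsOpen W) (hH : ContinuousOn H W) (k : ℕ) :
    IsOpen {x | ∀ i < k, H^[i] x ∈ W} := by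
  induction k with
  | zero => simp
  | succ k ih =>
    have : {x | ∀ i < k + 1, H^[i] x ∈ W} = W ∩ H ⁻¹' {x | ∀ i < k, H^[i] x ∈ W} := by
      ext x
      constructor
      · intro h
        refine ⟨h 0 (by omega), fun i hi => ?_⟩
        have := h (i + 1) (by omega)
        rwa [Function.iterate_succ_apply] at this
      · rintro ⟨h0, h1⟩ i hi
        rcases i with _ | i
        · exact h0
        · rw [Function.iterate_succ_apply]
          exact h1 i (by omega)
    rw [this]
    exact hH.isOpen_inter_preimage hW ih

theorem pp_newman_zero (m : ℕ) : 0 < m → ∀ (H : ℂ → ℂ) (W : Set ℂ) (r : ℝ), IsOpen W → 0 < r →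
    ContinuousOn H W → (∀ x ∈ W, H^[m] x = x) → closedBall (0 : ℂ) r ⊆ W →
    (∀ x ∈ closedBall (0 : ℂ) r, H x = x) → ∃ ρ, r < ρ ∧ ∀ x ∈ ball (0 : ℂ) ρ, H x = x := by
  induction m using Nat.strong_induction_on with
  | _ m ih =>
    intro hm H W r hW hr hH hper hrW hfix
    rcases eq_or_ne m 1 with rfl | hm1
    · obtain ⟨ρ, h1, h2⟩ := pp_enlarge r hr W hW hrW
      exact ⟨ρ, h1, fun x hx => hper x (h2 (ball_subset_closedBall hx))⟩
    · set W' : Set ℂ := {x | ∀ i < m, H^[i] x ∈ W} with hW'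
      have hsub : W' ⊆ W := fun x hx => hx 0 hm
      have hfixi : ∀ x ∈ closedBall (0 : ℂ) r, ∀ i, H^[i] x = x := fun x hx i =>
        Function.iterate_fixed (hfix x hx) i
      have hrW' : closedBall (0 : ℂ) r ⊆ W' := by
        intro x hx i _
        rw [hfixi x hx i]
        exact hrW hx
      have hmaps : MapsTo H W' W' := by
        intro x hx i hi
        rw [← Function.iterate_succ_apply]
        rcases Nat.lt_or_ge (i + 1) m with h | h
        · exact hx _ h
        · have : i + 1 = m := by omega
          rw [Nat.succ_eq_add_one, this, hper x (hsub hx)]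
          exact hsub hx
      obtain ⟨q, hq⟩ := Nat.minFac_dvd m
      have hp := Nat.minFac_prime hm1
      set p := m.minFac
      have hq0 : 0 < q := by
        rcases Nat.eq_zero_or_pos q with h | h
        · subst h; omega
        · exact h
      have hqm : q < m := by
        have := hp.two_le
        nlinarith
      have hact : PPAct p W' H^[q] :=
        { pos := hp.pos
          isOpen := pp_iter_open H W hW hH m
          maps := hmaps.iterate q
          cont := (hH.mono hsub).iterate hmaps q
          per := by
            intro x hx
            rw [← Function.iterate_mul, mul_comm, ← hq]
            exact hper x (hsub hx) }
      obtain ⟨ρ, hρ, hρf⟩ := hact.newman_prime hp hr hrW' (fun x hx => hfixi x hx q)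
      exact ih q hqm hq0 H (W' ∩ ball 0 ρ) r (hact.isOpen.inter isOpen_ball) hr
        (hH.mono (inter_subset_left.trans hsub)) (fun x hx => hρf x hx.2)
        (subset_inter hrW' (closedBall_subset_ball hρ)) hfix

theorem pp_newman_center (m : ℕ) (hm : 0 < m) (H : ℂ → ℂ) (W : Set ℂ) (c : ℂ) (r : ℝ)
    (hW : IsOpen W) (hr : 0 < r)
    (hH : ContinuousOn H W) (hper : ∀ x ∈ W, H^[m] x = x) (hrW : closedBall c r ⊆ W)
    (hfix : ∀ x ∈ closedBall c r, H x = x) : ∃ ρ, r < ρ ∧ ∀ x ∈ ball c ρ, H x = x := by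
  have hsemi : Function.Semiconj (fun x => x + c) (fun x => H (x + c) - c) H := by
    intro x; simp
  have hcont : Continuous (fun x : ℂ => x + c) := by fun_prop
  obtain ⟨ρ, h1, h2⟩ := pp_newman_zero m hm (fun x => H (x + c) - c) ((fun x => x + c) ⁻¹' W) r
    (hW.preimage hcont) hr
    ((hH.comp hcont.continuousOn (fun x hx => hx)).sub continuousOn_const)
    (by
      intro x hx
      have := hsemi.iterate_right m x
      rw [hper _ hx] at this
      simpa using this)
    (by
      intro x hx
      apply hrW
      simpa [mem_closedBall, dist_eq_norm] using hx)
    (by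
      intro x hx
      have := hfix (x + c) (by simpa [mem_closedBall, dist_eq_norm] using hx)
      simp [this])
  refine ⟨ρ, h1, fun x hx => ?_⟩
  have := h2 (x - c) (by simpa [mem_ball, dist_eq_norm] using hx)
  simpa using this

theorem pp_newman (m : ℕ) (hm : 0 < m) (H : ℂ → ℂ) (V : Set ℂ) (hV : IsOpen V)
    (hVc : IsPreconnected V) (hH : ContinuousOn H V) (hper : ∀ x ∈ V, H^[m] x = x)
    (hne : (V ∩ interior {x | H x = x}).Nonempty) : ∀ x ∈ V, H x = x := by
  set O := interior {x | H x = x} with hO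
  have hOo : IsOpen O := isOpen_interior
  have key : V ∩ closure O ⊆ O := by
    rintro b0 ⟨hb0V, hb0⟩
    by_contra hb0O
    obtain ⟨ε, hε, hεV⟩ := Metric.isOpen_iff.1 hV b0 hb0V
    obtain ⟨c, hcO, hc⟩ := Metric.mem_closure_iff.1 hb0 (ε / 2) (by positivity)
    have hclosed : IsClosed Oᶜ := hOo.isClosed_compl
    have hnon : (Oᶜ).Nonempty := ⟨b0, hb0O⟩
    obtain ⟨b, hb, hbd⟩ := hclosed.exists_infDist_eq_dist hnon c
    set r := dist c b with hr
    have hr0 : 0 < r := by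
      rw [hr, dist_pos]
      rintro rfl
      exact hb hcO
    have hrle : r ≤ dist c b0 := by
      rw [← hbd]; exact infDist_le_dist_of_mem hb0O
    have hballO : ball c r ⊆ O := by
      intro x hx
      by_contra hxO
      have := infDist_le_dist_of_mem (x := c) (show x ∈ Oᶜ from hxO)
      rw [hbd, dist_comm c x] at this
      exact absurd (mem_ball.1 hx) (not_lt.2 this)
    have hcbV : closedBall c r ⊆ V := by
      intro x hx
      apply hεV
      rw [mem_ball]
      have := dist_triangle x c b0
      rw [dist_comm b0 c] at hc
      have := mem_closedBall.1 hx
      linarith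
    have hfixc : ∀ x ∈ closedBall c r, H x = x := by
      have heq : EqOn H id (ball c r) := fun x hx => pp_fix_of_int (hballO hx)
      have := heq.of_subset_closure (t := closedBall c r) (hH.mono hcbV) continuousOn_id
        ball_subset_closedBall (by rw [closure_ball c hr0.ne'])
      exact fun x hx => this hx
    obtain ⟨ρ, hρ, hρf⟩ := pp_newman_center m hm H V c r hV hr0 hH hper hcbV hfixc
    apply hb
    rw [hO, mem_interior]
    refine ⟨ball c ρ, hρf, isOpen_ball, ?_⟩
    rw [mem_ball, dist_comm]
    exact hρ
  have hsub : V ⊆ O := by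
    apply hVc.subset_of_closure_inter_subset hOo hne
    intro x hx
    exact key ⟨hx.2, hx.1⟩
  exact fun x hx => pp_fix_of_int (hsub hx)

theorem pp_plane (F : ℂ ≃ₜ ℂ) (hpp : ∀ x : ℂ, ∃ n : ℕ, 1 ≤ n ∧ F^[n] x = x) :
    ∃ n : ℕ, 1 ≤ n ∧ ∀ x : ℂ, F^[n] x = x := by
  have hFc : ∀ n, Continuous F^[n] := fun n => F.continuous.iterate n
  have hcl : ∀ n, IsClosed {x | F^[n] x = x} := fun n => isClosed_eq (hFc n) continuous_id
  set D : Set ℂ := {x | ∃ m : ℕ, 0 < m ∧ x ∈ interior {x | F^[m] x = x}} with hD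
  have hDo : IsOpen D := by
    have : D = ⋃ m : ℕ, ⋃ _ : 0 < m, interior {x | F^[m] x = x} := by
      ext x; simp [hD]
    rw [this]
    exact isOpen_iUnion fun m => isOpen_iUnion fun _ => isOpen_interior
  -- limit points of interior fixed sets inside `D`
  have hlim : ∀ k : ℕ, ∀ x ∈ D, x ∈ closure (interior {x | F^[k] x = x}) →
      x ∈ interior {x | F^[k] x = x} := by
    rintro k x ⟨M, hM, hxM⟩ hx
    obtain ⟨ε, hε, hB⟩ := Metric.isOpen_iff.1 isOpen_interior x hxM
    have hall := pp_newman M hM F^[k] (ball x ε) isOpen_ball (convex_ball x ε).isPreconnected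
      (hFc k).continuousOn
      (by
        intro y hy
        rw [← Function.iterate_mul, mul_comm, Function.iterate_mul]
        exact Function.iterate_fixed (show F^[M] y = y from pp_fix_of_int (hB hy)) k)
      (mem_closure_iff.1 hx _ isOpen_ball (mem_ball_self hε))
    rw [mem_interior]
    exact ⟨ball x ε, hall, isOpen_ball, mem_ball_self hε⟩
  by_cases hDu : D = univ
  · obtain ⟨m, hm, h0⟩ : (0 : ℂ) ∈ D := by rw [hDu]; trivial
    refine ⟨m, hm, fun x => ?_⟩
    have hclop : IsClopen (interior {x | F^[m] x = x}) := by
      refine ⟨?_, isOpen_interior⟩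
      apply isClosed_of_closure_subset
      intro y hy
      exact hlim m y (by rw [hDu]; trivial) hy
    have := hclop.eq_univ ⟨0, h0⟩
    have hx : x ∈ interior {x | F^[m] x = x} := by rw [this]; trivial
    exact pp_fix_of_int hx
  exfalso
  obtain ⟨x0, hx0⟩ := (ne_univ_iff_exists_notMem D).1 hDu
  have hCc : IsClosed Dᶜ := hDo.isClosed_compl
  have : CompleteSpace (Dᶜ : Set ℂ) := hCc.completeSpace_coe
  have : Nonempty (Dᶜ : Set ℂ) := ⟨⟨x0, hx0⟩⟩
  obtain ⟨k, z, hz⟩ := nonempty_interior_of_iUnion_of_closed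
    (X := (Dᶜ : Set ℂ)) (f := fun k : ℕ => {x : (Dᶜ : Set ℂ) | F^[k + 1] (x : ℂ) = x})
    (fun k => (hcl (k + 1)).preimage continuous_subtype_val)
    (by
      ext x
      simp only [mem_iUnion, mem_univ, iff_true]
      obtain ⟨n, hn, hx⟩ := hpp x
      refine ⟨n - 1, ?_⟩
      show F^[n - 1 + 1] (x : ℂ) = x
      rwa [Nat.sub_add_cancel hn])
  set n := k + 1 with hn
  have hnpos : 0 < n := Nat.succ_pos k
  obtain ⟨ε, hε, hball⟩ := Metric.isOpen_iff.1 isOpen_interior z hz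
  set V : Set ℂ := ball (z : ℂ) ε with hVdef
  have hVo : IsOpen V := isOpen_ball
  have hzV : (z : ℂ) ∈ V := mem_ball_self hε
  have hVC : ∀ x ∈ V, x ∉ D → F^[n] x = x := by
    intro x hx hxD
    have : (⟨x, hxD⟩ : (Dᶜ : Set ℂ)) ∈ ball z ε := hx
    have h2 := interior_subset (hball this)
    exact h2
  have hzD : (z : ℂ) ∉ D := z.2
  have hVnot : ∀ m : ℕ, 0 < m → ¬ ∀ x ∈ V, F^[m] x = x := by
    intro m hm h
    exact hzD ⟨m, hm, mem_interior.2 ⟨V, h, hVo, hzV⟩⟩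
  set G : ℂ → ℂ := F^[n] with hG
  have hGm : ∀ m, G^[m] = F^[n * m] := fun m => (Function.iterate_mul F n m).symm
  have hGopen : IsOpenMap G := by
    rw [hG]
    exact pp_openMap_iterate F.isOpenMap n
  have hY : ∀ m : ℕ, 0 < m → ∀ x ∈ V, x ∈ interior {x | G^[m] x = x} → G x = x := by
    intro m hm x hxV hxY
    classical
    set Y := interior {x | G^[m] x = x} with hYdef
    have hYinv : MapsTo G Y Y := by
      intro y hy
      rw [hYdef, mem_interior]
      refine ⟨G '' Y, ?_, hGopen _ isOpen_interior, mem_image_of_mem G hy⟩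
      rintro _ ⟨w, hw, rfl⟩
      show G^[m] (G w) = G w
      rw [← Function.iterate_succ_apply, Function.iterate_succ_apply',
        show G^[m] w = w from pp_fix_of_int hw]
    set H : ℂ → ℂ := Y.piecewise G id with hHdef
    have hHY : ∀ y ∈ Y, H y = G y := fun y hy => Set.piecewise_eq_of_mem _ _ _ hy
    have hHN : ∀ y, y ∉ Y → H y = y := fun y hy => Set.piecewise_eq_of_notMem _ _ _ hy
    have hHiter : ∀ i, ∀ y ∈ Y, H^[i] y = G^[i] y ∧ H^[i] y ∈ Y := by
      intro i
      induction i with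
      | zero => intro y hy; exact ⟨rfl, hy⟩
      | succ i ih =>
        intro y hy
        rw [Function.iterate_succ_apply, Function.iterate_succ_apply, hHY y hy]
        exact ih _ (hYinv hy)
    have hHper : ∀ y, H^[m] y = y := by
      intro y
      by_cases hy : y ∈ Y
      · rw [(hHiter m y hy).1]
        exact pp_fix_of_int hy
      · exact Function.iterate_fixed (hHN y hy) m
    have hfr : ∀ y ∈ V, y ∈ frontier Y → G y = y := by
      intro y hyV hy
      apply hVC y hyV
      intro hyD
      have h1 := hlim (n * m) y hyD (by rw [← hGm]; exact hy.1)
      rw [← hGm] at h1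
      exact hy.2 (by rw [isOpen_interior.interior_eq]; exact h1)
    have hHc : ContinuousOn H V := by
      apply ContinuousOn.piecewise
      · rintro y ⟨hyV, hyf⟩
        exact hfr y hyV hyf
      · exact (hFc n).continuousOn
      · exact continuousOn_id
    have hnsub : ¬ V ⊆ closure Y := by
      intro hsub
      apply hVnot (n * m) (Nat.mul_pos hnpos hm)
      intro y hy
      have : closure Y ⊆ {x | F^[n * m] x = x} := by
        apply closure_minimal _ (hcl (n * m))
        rw [hYdef, hGm]
        exact interior_subset
      exact this (hsub hy)
    obtain ⟨w, hwV, hwY⟩ := not_subset.1 hnsub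
    have := pp_newman m hm H V hVo (convex_ball _ _).isPreconnected hHc (fun y _ => hHper y)
      ⟨w, hwV, mem_interior.2 ⟨(closure Y)ᶜ, fun y hy => hHN y (fun h => hy (subset_closure h)),
        isClosed_closure.isOpen_compl, hwY⟩⟩ x hxV
    rwa [hHY x hxY] at this
  apply hVnot n hnpos
  intro x hxV
  by_cases hxD : x ∈ D
  · obtain ⟨M, hM, hxM⟩ := hxD
    refine hY M hM x hxV ?_
    refine interior_mono ?_ hxM
    intro y hy
    show G^[M] y = y
    rw [hGm, mul_comm, Function.iterate_mul]
    exact Function.iterate_fixed hy n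
  · exact hVC x hxV hxD

theorem pp_sphere (F : (sphere (0 : EuclideanSpace ℝ (Fin 3)) 1) ≃ₜ
      (sphere (0 : EuclideanSpace ℝ (Fin 3)) 1))
    (hpp : ∀ x, ∃ n : ℕ, 1 ≤ n ∧ F^[n] x = x) :
    ∃ n : ℕ, 1 ≤ n ∧ ∀ x, F^[n] x = x := by
  have hfact : Fact (Module.finrank ℝ (EuclideanSpace ℝ (Fin 3)) = 2 + 1) := ⟨by simp⟩
  have q : sphere (0 : EuclideanSpace ℝ (Fin 3)) 1 :=
    ⟨EuclideanSpace.single 0 1, by simp⟩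
  obtain ⟨n, hn, hq⟩ := hpp q
  set G := F^[n] with hG
  set G' := F.symm^[n] with hG'
  have hGG' : Function.LeftInverse G G' := Function.LeftInverse.iterate F.apply_symm_apply n
  have hG'G : Function.LeftInverse G' G := Function.LeftInverse.iterate F.symm_apply_apply n
  have hGc : Continuous G := F.continuous.iterate n
  have hG'c : Continuous G' := F.symm.continuous.iterate n
  have hq' : G' q = q := by
    have := hG'G q
    rwa [hq] at this
  obtain ⟨e, hes, het⟩ : ∃ e : OpenPartialHomeomorph (sphere (0 : EuclideanSpace ℝ (Fin 3)) 1) ℂ,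
      e.source = {q}ᶜ ∧ e.target = univ := by
    refine ⟨(stereographic' 2 q).trans
      Complex.orthonormalBasisOneI.repr.symm.toHomeomorph.toOpenPartialHomeomorph, ?_, ?_⟩ <;>
      simp
  have hsymm : ∀ z, e.symm z ≠ q := by
    intro z
    have := e.map_target (x := z) (by rw [het]; trivial)
    rw [hes] at this
    exact this
  have hGne : ∀ x, x ≠ q → G x ≠ q := by
    intro x hx h
    apply hx
    rw [← hG'G x, h, hq']
  have hG'ne : ∀ x, x ≠ q → G' x ≠ q := by
    intro x hx h
    apply hx
    rw [← hGG' x, h, hq]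
  have hleft : ∀ x, x ≠ q → e.symm (e x) = x := fun x hx => e.left_inv (by rw [hes]; exact hx)
  have hright : ∀ z, e (e.symm z) = z := fun z => e.right_inv (by rw [het]; trivial)
  have hesc : Continuous e.symm := by
    have := e.continuousOn_symm
    rwa [het, continuousOn_univ] at this
  have hec : ∀ g : ℂ → sphere (0 : EuclideanSpace ℝ (Fin 3)) 1, Continuous g → (∀ z, g z ≠ q) →
      Continuous (fun z => e (g z)) := by
    intro g hg hgq
    refine e.continuousOn.comp_continuous hg (fun z => ?_)
    rw [hes]
    exact hgq z
  let K : ℂ ≃ₜ ℂ :=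
    { toFun := fun z => e (G (e.symm z))
      invFun := fun z => e (G' (e.symm z))
      left_inv := by
        intro z
        simp only
        rw [hleft _ (hGne _ (hsymm z)), hG'G, hright]
      right_inv := by
        intro z
        simp only
        rw [hleft _ (hG'ne _ (hsymm z)), hGG', hright]
      continuous_toFun := hec _ (hGc.comp hesc) (fun z => hGne _ (hsymm z))
      continuous_invFun := hec _ (hG'c.comp hesc) (fun z => hG'ne _ (hsymm z)) }
  have hsemi : Function.Semiconj e.symm K G := by
    intro z
    exact hleft _ (hGne _ (hsymm z))
  obtain ⟨k, hk, hK⟩ := pp_plane K (by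
    intro z
    obtain ⟨m, hm, h⟩ := hpp (e.symm z)
    refine ⟨m, hm, ?_⟩
    have h1 := hsemi.iterate_right m z
    have h2 : G^[m] (e.symm z) = e.symm z := by
      rw [hG, ← Function.iterate_mul, mul_comm, Function.iterate_mul]
      exact Function.iterate_fixed h n
    rw [h2] at h1
    rw [← hright (K^[m] z), h1, hright])
  refine ⟨n * k, Nat.mul_pos hn hk, fun x => ?_⟩
  rw [Function.iterate_mul]
  by_cases hx : x = q
  · rw [hx]
    exact Function.iterate_fixed hq k
  · have h1 := hsemi.iterate_right k (e x)
    rw [hK, hleft x hx] at h1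
    exact h1.symm

end PPHelpers

/-- Montgomery's theorem in the case of the 2-sphere: a pointwise periodic
homeomorphism of `S²` is periodic. -/
theorem pointwise_periodic_homeo_of_sphere_is_periodic
    (F : Sphere2 ≃ₜ Sphere2)
    (hpp : ∀ x : Sphere2, ∃ n : ℕ, 1 ≤ n ∧ F^[n] x = x) :
    ∃ n : ℕ, 1 ≤ n ∧ ∀ x : Sphere2, F^[n] x = x := by
  exact pp_sphere F hpp
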